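/- Let A, Φ ∈ ℂ^{m×d}, let s ≥ 1, and suppose A satisfies the restricted isometry property with parameters (s, δ) for some 0 ≤ δ < 1. Let x ∈ ℂ^d and suppose the quantity D := √(1 − δ) ‖x_s‖₂ − √(1 + δ) ( ‖x − x_s‖₂ + ‖x − x_s‖₁/√s ) is strictly positive. Then ‖(A − Φ)x‖₂ ≤ ( (‖A − Φ‖₂ ‖x − x_s‖₂ + ‖A − Φ‖^{(s)} ‖x_s‖₂) / D ) · ‖Ax‖₂. -/

import Mathlib

open scoped BigOperators

/-- The Euclidean (ℓ²) norm of a vector. -/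
noncomputable def l2 {n : ℕ} (x : Fin n → ℂ) : ℝ := Real.sqrt (∑ i, ‖x i‖ ^ 2)

/-- The ℓ¹ norm of a vector. -/
noncomputable def l1 {n : ℕ} (x : Fin n → ℂ) : ℝ := ∑ i, ‖x i‖

/-- `x` has at most `s` nonzero entries. -/
def Sparse {n : ℕ} (s : ℕ) (x : Fin n → ℂ) : Prop :=
  ∃ T : Finset (Fin n), T.card ≤ s ∧ ∀ i ∉ T, x i = 0

/-- `A` satisfies the restricted isometry property with parameters `(s, δ)`. -/
def RIP {m d : ℕ} (A : Matrix (Fin m) (Fin d) ℂ) (s : ℕ) (δ : ℝ) : Prop :=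
  ∀ x : Fin d → ℂ, Sparse s x →
    (1 - δ) * (l2 x) ^ 2 ≤ (l2 (A.mulVec x)) ^ 2 ∧
      (l2 (A.mulVec x)) ^ 2 ≤ (1 + δ) * (l2 x) ^ 2

/-- The spectral norm `‖M‖₂` of a matrix. -/
noncomputable def specNorm {m d : ℕ} (M : Matrix (Fin m) (Fin d) ℂ) : ℝ :=
  sSup {r | ∃ x : Fin d → ℂ, l2 x ≤ 1 ∧ r = l2 (M.mulVec x)}

/-- `‖M‖^{(s)}`: the largest spectral norm over all `s`-column submatrices of `M`,
equivalently the sup of `‖Mx‖₂` over `s`-sparse `x` with `‖x‖₂ ≤ 1`. -/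
noncomputable def specNormS {m d : ℕ} (s : ℕ) (M : Matrix (Fin m) (Fin d) ℂ) : ℝ :=
  sSup {r | ∃ x : Fin d → ℂ, Sparse s x ∧ l2 x ≤ 1 ∧ r = l2 (M.mulVec x)}

/-- `xs` is a best `s`-sparse approximation of `x`: it keeps `s` entries of `x` of
largest magnitude (all entries if `x` has fewer than `s` coordinates) and sets the
others to zero. -/
def IsSparseApprox {n : ℕ} (s : ℕ) (x xs : Fin n → ℂ) : Prop :=
  ∃ T : Finset (Fin n), T.card = min s n ∧
    (∀ i, xs i = if i ∈ T then x i else 0) ∧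
    ∀ i ∈ T, ∀ j ∉ T, ‖x j‖ ≤ ‖x i‖

theorem l2_eq_norm {n : ℕ} (x : Fin n → ℂ) : l2 x = ‖WithLp.toLp 2 x‖ := by
  rw [l2, EuclideanSpace.norm_eq]

theorem l2_nonneg {n : ℕ} (x : Fin n → ℂ) : 0 ≤ l2 x := Real.sqrt_nonneg _

theorem l2_zero {n : ℕ} : l2 (0 : Fin n → ℂ) = 0 := by simp [l2]

theorem l2_add_le {n : ℕ} (x y : Fin n → ℂ) : l2 (x + y) ≤ l2 x + l2 y := by
  simpa only [l2_eq_norm, WithLp.toLp_add] using norm_add_le _ _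

theorem l2_smul {n : ℕ} (c : ℂ) (x : Fin n → ℂ) : l2 (c • x) = ‖c‖ * l2 x := by
  simpa only [l2_eq_norm, WithLp.toLp_smul] using norm_smul _ _

theorem eq_zero_of_l2_eq_zero {n : ℕ} {x : Fin n → ℂ} (h : l2 x = 0) : x = 0 := by
  rw [l2_eq_norm, norm_eq_zero] at h
  simpa using congrArg WithLp.ofLp h

theorem exists_l2_mulVec_le {m d : ℕ} (M : Matrix (Fin m) (Fin d) ℂ) :
    ∃ C, 0 ≤ C ∧ ∀ x, l2 (M.mulVec x) ≤ C * l2 x := by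
  let L := LinearMap.toContinuousLinearMap (Matrix.toEuclideanLin M)
  refine ⟨‖L‖, norm_nonneg _, fun x => ?_⟩
  rw [l2_eq_norm, l2_eq_norm]
  exact L.le_opNorm (WithLp.toLp 2 x)

/-- The supremum of `l2 (M.mulVec x)` over the part of the unit ball lying in a cone is a
Lipschitz bound on that cone. -/
theorem l2_mulVec_le_sSup_mul {m d : ℕ} (M : Matrix (Fin m) (Fin d) ℂ)
    {P : (Fin d → ℂ) → Prop} (hP : ∀ (c : ℂ) x, P x → P (c • x)) {x : Fin d → ℂ} (hx : P x) :
    l2 (M.mulVec x) ≤ sSup {r | ∃ x, P x ∧ l2 x ≤ 1 ∧ r = l2 (M.mulVec x)} * l2 x := by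
  rcases (l2_nonneg x).eq_or_lt with h0 | hpos
  · simp [eq_zero_of_l2_eq_zero h0.symm, l2_zero]
  obtain ⟨C, hC, hM⟩ := exists_l2_mulVec_le M
  have hbdd : BddAbove {r | ∃ x, P x ∧ l2 x ≤ 1 ∧ r = l2 (M.mulVec x)} := by
    refine ⟨C, ?_⟩
    rintro _ ⟨y, -, hy, rfl⟩
    exact (hM y).trans (mul_le_of_le_one_right hC hy)
  have hc : ‖(((l2 x)⁻¹ : ℝ) : ℂ)‖ = (l2 x)⁻¹ := by
    rw [Complex.norm_real, Real.norm_of_nonneg (inv_nonneg.2 hpos.le)]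
  have h := le_csSup hbdd ⟨(((l2 x)⁻¹ : ℝ) : ℂ) • x, hP _ _ hx,
    by rw [l2_smul, hc, inv_mul_cancel₀ hpos.ne'], rfl⟩
  rwa [Matrix.mulVec_smul, l2_smul, hc, inv_mul_le_iff₀ hpos, mul_comm] at h

theorem l2_mulVec_le_specNorm_mul {m d : ℕ} (M : Matrix (Fin m) (Fin d) ℂ) (x : Fin d → ℂ) :
    l2 (M.mulVec x) ≤ specNorm M * l2 x := by
  simpa [specNorm] using
    l2_mulVec_le_sSup_mul M (P := fun _ => True) (fun _ _ _ => trivial) (x := x) trivial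

theorem Sparse.smul {n s : ℕ} {x : Fin n → ℂ} (hx : Sparse s x) (c : ℂ) : Sparse s (c • x) := by
  obtain ⟨T, hT, h⟩ := hx
  exact ⟨T, hT, fun i hi => by simp [h i hi]⟩

theorem l2_mulVec_le_specNormS_mul {m d s : ℕ} (M : Matrix (Fin m) (Fin d) ℂ) {x : Fin d → ℂ}
    (hx : Sparse s x) : l2 (M.mulVec x) ≤ specNormS s M * l2 x :=
  l2_mulVec_le_sSup_mul M (fun c _ h => h.smul c) hx

theorem RIP.sqrt_mul_le {m d s : ℕ} {A : Matrix (Fin m) (Fin d) ℂ} {δ : ℝ} (hA : RIP A s δ)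
    {x : Fin d → ℂ} (hx : Sparse s x) : √(1 - δ) * l2 x ≤ l2 (A.mulVec x) := by
  have h := Real.sqrt_le_sqrt (hA x hx).1
  rwa [Real.sqrt_sq (l2_nonneg _), Real.sqrt_mul' _ (sq_nonneg _), Real.sqrt_sq (l2_nonneg _)] at h

theorem RIP.le_sqrt_mul {m d s : ℕ} {A : Matrix (Fin m) (Fin d) ℂ} {δ : ℝ} (hA : RIP A s δ)
    {x : Fin d → ℂ} (hx : Sparse s x) : l2 (A.mulVec x) ≤ √(1 + δ) * l2 x := by
  have h := Real.sqrt_le_sqrt (hA x hx).2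
  rwa [Real.sqrt_sq (l2_nonneg _), Real.sqrt_mul' _ (sq_nonneg _), Real.sqrt_sq (l2_nonneg _)] at h

theorem exists_subset_card_eq_forall_le {ι : Type*} [DecidableEq ι] (f : ι → ℝ) (S : Finset ι)
    (s : ℕ) (hs : s ≤ S.card) :
    ∃ T ⊆ S, T.card = s ∧ ∀ i ∈ T, ∀ j ∈ S \ T, f j ≤ f i := by
  induction s with
  | zero => exact ⟨∅, by simp⟩
  | succ k ih =>
    obtain ⟨T, hTS, hcard, hT⟩ := ih (by omega)
    have hne : (S \ T).Nonempty := by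
      rw [← Finset.card_pos, Finset.card_sdiff_of_subset hTS]
      omega
    obtain ⟨a, ha, hmax⟩ := Finset.exists_max_image (S \ T) f hne
    have haS := Finset.mem_sdiff.1 ha
    refine ⟨insert a T, Finset.insert_subset haS.1 hTS, by simp [haS.2, hcard], ?_⟩
    intro i hi j hj
    have hj' : j ∈ S \ T := by
      simp only [Finset.mem_sdiff, Finset.mem_insert, not_or] at hj ⊢
      exact ⟨hj.1, hj.2.2⟩
    rcases Finset.mem_insert.1 hi with rfl | hi
    · exact hmax j hj'
    · exact hT i hi j hj'

section Restriction

variable {d : ℕ}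

theorem sparse_piecewise {s : ℕ} (S : Finset (Fin d)) (u : Fin d → ℂ) (hS : S.card ≤ s) :
    Sparse s (S.piecewise u 0) :=
  ⟨S, hS, fun i hi => by simp [hi]⟩

theorem l2_piecewise (S : Finset (Fin d)) (u : Fin d → ℂ) :
    l2 (S.piecewise u 0) = √(∑ i ∈ S, ‖u i‖ ^ 2) := by
  have h : ∀ i, ‖S.piecewise u 0 i‖ ^ 2 = if i ∈ S then ‖u i‖ ^ 2 else 0 := by
    intro i
    by_cases hi : i ∈ S <;> simp [hi]
  simp [l2, h]

theorem l2_piecewise_le (S : Finset (Fin d)) (u : Fin d → ℂ) : l2 (S.piecewise u 0) ≤ l2 u := by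
  rw [l2_piecewise, l2]
  exact Real.sqrt_le_sqrt
    (Finset.sum_le_univ_sum_of_nonneg fun i => sq_nonneg _)

theorem l2_piecewise_le_sqrt_mul {s : ℕ} {S : Finset (Fin d)} {u : Fin d → ℂ} {b : ℝ}
    (hS : S.card ≤ s) (hb : 0 ≤ b) (h : ∀ i ∈ S, ‖u i‖ ≤ b) :
    l2 (S.piecewise u 0) ≤ √s * b := by
  rw [l2_piecewise, ← Real.sqrt_sq hb, ← Real.sqrt_mul (Nat.cast_nonneg s)]
  refine Real.sqrt_le_sqrt ?_
  calc ∑ i ∈ S, ‖u i‖ ^ 2 ≤ S.card * b ^ 2 := by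
        rw [← nsmul_eq_mul]
        exact Finset.sum_le_card_nsmul _ _ _ fun i hi => by
          have := h i hi
          gcongr
    _ ≤ s * b ^ 2 := by gcongr

theorem piecewise_add_piecewise_sdiff {S T : Finset (Fin d)} (hTS : T ⊆ S) (u : Fin d → ℂ) :
    T.piecewise u 0 + (S \ T).piecewise u 0 = S.piecewise u 0 := by
  ext i
  by_cases hT : i ∈ T
  · simp [hT, hTS hT]
  · by_cases hS : i ∈ S <;> simp [hT, hS]

/-- Splitting off the `s` largest entries of `u` on `S` costs the `ℓ²` norm of these entries, and
the rest is bounded by their average. -/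
theorem exists_top_block {s : ℕ} (hs : 1 ≤ s) (u : Fin d → ℂ) {S : Finset (Fin d)}
    (hS : s < S.card) :
    ∃ T ⊆ S, T.card = s ∧ ∃ b, 0 ≤ b ∧ (∀ j ∈ S \ T, ‖u j‖ ≤ b) ∧
      √s * b ≤ (∑ i ∈ T, ‖u i‖) / √s := by
  obtain ⟨T, hTS, hcard, hT⟩ := exists_subset_card_eq_forall_le (fun i => ‖u i‖) S s hS.le
  obtain ⟨a, ha, hmin⟩ := Finset.exists_min_image T (fun i => ‖u i‖)
    (Finset.card_pos.1 (by omega))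
  refine ⟨T, hTS, hcard, ‖u a‖, norm_nonneg _, hT a ha, ?_⟩
  have hs0 : (0 : ℝ) < s := by exact_mod_cast hs
  rw [le_div_iff₀ (Real.sqrt_pos.2 hs0), mul_right_comm, Real.mul_self_sqrt hs0.le, ← hcard,
    ← nsmul_eq_mul]
  exact Finset.card_nsmul_le_sum _ _ _ hmin

variable {m s : ℕ} {A : Matrix (Fin m) (Fin d) ℂ} {K : ℝ}

theorem l2_mulVec_piecewise_le_of_forall_le (hs : 1 ≤ s) (hK : 0 ≤ K)
    (hA : ∀ v, Sparse s v → l2 (A.mulVec v) ≤ K * l2 v) (u : Fin d → ℂ) (S : Finset (Fin d))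
    {b : ℝ} (hb : 0 ≤ b) (h : ∀ i ∈ S, ‖u i‖ ≤ b) :
    l2 (A.mulVec (S.piecewise u 0)) ≤ K * (√s * b + (∑ i ∈ S, ‖u i‖) / √s) := by
  induction S using Finset.strongInduction generalizing b with
  | H S ih =>
    rcases le_or_gt S.card s with hS | hS
    · refine (hA _ (sparse_piecewise S u hS)).trans (mul_le_mul_of_nonneg_left ?_ hK)
      exact (l2_piecewise_le_sqrt_mul hS hb h).trans (le_add_of_nonneg_right (by positivity))
    · obtain ⟨T, hTS, hcard, c, hc, hc', hcT⟩ := exists_top_block hs u hS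
      have hlt : S \ T ⊂ S := Finset.sdiff_ssubset hTS (Finset.card_pos.1 (by omega))
      have h₁ := (hA _ (sparse_piecewise T u hcard.le)).trans (mul_le_mul_of_nonneg_left
        (l2_piecewise_le_sqrt_mul hcard.le hb fun i hi => h i (hTS hi)) hK)
      have h₂ := ih _ hlt hc hc'
      rw [← piecewise_add_piecewise_sdiff hTS, Matrix.mulVec_add]
      calc _ ≤ K * (√s * b) + K * (√s * c + (∑ i ∈ S \ T, ‖u i‖) / √s) :=
            (l2_add_le _ _).trans (add_le_add h₁ h₂)
        _ ≤ K * (√s * b) + K * ((∑ i ∈ T, ‖u i‖) / √s + (∑ i ∈ S \ T, ‖u i‖) / √s) := by gcongr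
        _ = _ := by rw [← Finset.sum_sdiff hTS]; ring

/-- A matrix with norm at most `K` on `s`-sparse vectors satisfies
`‖A u‖₂ ≤ K (‖u‖₂ + ‖u‖₁ / √s)` for every vector `u`. -/
theorem l2_mulVec_le_l2_add_l1 (hs : 1 ≤ s) (hK : 0 ≤ K)
    (hA : ∀ v, Sparse s v → l2 (A.mulVec v) ≤ K * l2 v) (u : Fin d → ℂ) :
    l2 (A.mulVec u) ≤ K * (l2 u + l1 u / √s) := by
  have hl1 : 0 ≤ l1 u := Finset.sum_nonneg fun i _ => norm_nonneg _
  rcases le_or_gt (Finset.univ : Finset (Fin d)).card s with hS | hS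
  · refine (hA u ⟨Finset.univ, hS, by simp⟩).trans (mul_le_mul_of_nonneg_left ?_ hK)
    exact le_add_of_nonneg_right (by positivity)
  · obtain ⟨T, hTS, hcard, c, hc, hc', hcT⟩ := exists_top_block hs u hS
    have h₁ := (hA _ (sparse_piecewise T u hcard.le)).trans
      (mul_le_mul_of_nonneg_left (l2_piecewise_le T u) hK)
    have h₂ := l2_mulVec_piecewise_le_of_forall_le hs hK hA u _ hc hc'
    have hu := piecewise_add_piecewise_sdiff hTS u
    rw [Finset.piecewise_univ] at hu
    calc l2 (A.mulVec u) = l2 (A.mulVec (T.piecewise u 0) +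
          A.mulVec ((Finset.univ \ T).piecewise u 0)) := by rw [← Matrix.mulVec_add, hu]
      _ ≤ K * l2 u + K * (√s * c + (∑ i ∈ Finset.univ \ T, ‖u i‖) / √s) :=
          (l2_add_le _ _).trans (add_le_add h₁ h₂)
      _ ≤ K * l2 u + K * ((∑ i ∈ T, ‖u i‖) / √s + (∑ i ∈ Finset.univ \ T, ‖u i‖) / √s) := by
          gcongr
      _ = _ := by rw [l1, ← Finset.sum_sdiff hTS]; ring

end Restriction

/-- Bounding the multiplicative noise relative to `‖Ax‖₂` when the lower energy
bound `D` is positive. -/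
theorem mult_noise_relative (m d s : ℕ) (hs : 1 ≤ s)
    (A Φ : Matrix (Fin m) (Fin d) ℂ)
    (δ : ℝ) (hδ0 : 0 ≤ δ) (hδ1 : δ < 1) (hRIP : RIP A s δ)
    (x xs : Fin d → ℂ) (hxs : IsSparseApprox s x xs)
    (hD : 0 < Real.sqrt (1 - δ) * l2 xs
        - Real.sqrt (1 + δ) * (l2 (x - xs) + l1 (x - xs) / Real.sqrt s)) :
    l2 ((A - Φ).mulVec x)
      ≤ (specNorm (A - Φ) * l2 (x - xs) + specNormS s (A - Φ) * l2 xs)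
          / (Real.sqrt (1 - δ) * l2 xs
              - Real.sqrt (1 + δ) * (l2 (x - xs) + l1 (x - xs) / Real.sqrt s))
        * l2 (A.mulVec x) := by
  have hsparse : Sparse s xs := by
    obtain ⟨T, hT, h, -⟩ := hxs
    exact ⟨T, hT.trans_le (min_le_left _ _), fun i hi => by simp [h i, hi]⟩
  have hlow : √(1 - δ) * l2 xs - √(1 + δ) * (l2 (x - xs) + l1 (x - xs) / √s)
      ≤ l2 (A.mulVec x) := by
    have h₁ := hRIP.sqrt_mul_le hsparse
    have h₂ := l2_mulVec_le_l2_add_l1 hs (Real.sqrt_nonneg (1 + δ))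
      (fun _ => hRIP.le_sqrt_mul) (xs - x)
    have h₃ := l2_add_le (A.mulVec x) (A.mulVec (xs - x))
    rw [← Matrix.mulVec_add, add_sub_cancel] at h₃
    have h2 : l2 (xs - x) = l2 (x - xs) := by simp only [l2, Pi.sub_apply, norm_sub_rev]
    have h1 : l1 (xs - x) = l1 (x - xs) := by simp only [l1, Pi.sub_apply, norm_sub_rev]
    rw [h1, h2] at h₂
    linarith
  have hup : l2 ((A - Φ).mulVec x)
      ≤ specNorm (A - Φ) * l2 (x - xs) + specNormS s (A - Φ) * l2 xs := by
    have h := l2_add_le ((A - Φ).mulVec (x - xs)) ((A - Φ).mulVec xs)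
    rw [← Matrix.mulVec_add, sub_add_cancel] at h
    exact h.trans (add_le_add (l2_mulVec_le_specNorm_mul _ _)
      (l2_mulVec_le_specNormS_mul _ hsparse))
  rw [div_mul_eq_mul_div, le_div_iff₀ hD]
  exact mul_le_mul hup hlow hD.le ((l2_nonneg _).trans hup)
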